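/- For every y = (y₁,y₂,y₃) with y₁, y₂, y₃ > 0, there exists a unique ρ = (ρ₁,ρ₂,ρ₃) with ρ₁, ρ₂, ρ₃ > 0 such that X_i(ρ) = y_i for i = 1, 2, 3. -/

import Mathlib

/-- The diagonal entry of the cross curvature (0,2)-tensor of the left-invariant
metric on `SU(2)` with diagonal entries `(a,b,c)` in a Milnor frame, in the direction
of the first entry:
`X(a,b,c) = ((a² + b² - 3c² - 2ab + 2ac + 2bc)(a² - 3b² + c² + 2ab - 2ac + 2bc)) / (16ab²c²)`.
It is symmetric in `b` and `c`. -/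
noncomputable def crossX (a b c : ℝ) : ℝ :=
  ((a ^ 2 + b ^ 2 - 3 * c ^ 2 - 2 * a * b + 2 * a * c + 2 * b * c) *
    (a ^ 2 - 3 * b ^ 2 + c ^ 2 + 2 * a * b - 2 * a * c + 2 * b * c)) /
    (16 * a * b ^ 2 * c ^ 2)

/-- The scale-invariant factor. -/
noncomputable def tScale (p q r : ℝ) : ℝ :=
  2 * ((p*q+p*r-q*r) * (p*q+q*r-p*r) * (p*r+q*r-p*q)) / ((q+r)*(p+r)*(p+q))^2

lemma crossX_ravi (p q r : ℝ) (hp : 0 < p) (hq : 0 < q) (hr : 0 < r) :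
    crossX ((q+r)/2) ((p+r)/2) ((p+q)/2)
      = 2 * ((p*q+q*r-p*r) * (p*r+q*r-p*q)) / ((q+r)*(p+r)^2*(p+q)^2) := by
  unfold crossX
  rw [div_eq_div_iff (by positivity) (by positivity)]
  ring

lemma key (p q r : ℝ) (hp : 0 < p) (hq : 0 < q) (hr : 0 < r)
    (hA : 0 < p*q+p*r-q*r) (hB : 0 < p*q+q*r-p*r) (hC : 0 < p*r+q*r-p*q) :
    1/(tScale p q r/p) - 1/(tScale p q r/q + tScale p q r/r)
      = 1/crossX ((q+r)/2) ((p+r)/2) ((p+q)/2) := by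
  rw [crossX_ravi p q r hp hq hr]
  have e : ∀ t : ℝ, 0 < t → 1/(t/p) - 1/(t/q+t/r) = (p*q+p*r-q*r)/(t*(q+r)) := by
    intro t ht
    field_simp
    ring
  have ht : 0 < tScale p q r := by unfold tScale; positivity
  rw [e _ ht]
  unfold tScale
  generalize p*q+p*r-q*r = A at *
  generalize p*q+q*r-p*r = B at *
  generalize p*r+q*r-p*q = C at *
  field_simp

lemma tScale_smul (k p q r : ℝ) (hk : 0 < k) (hp : 0 < p) (hq : 0 < q) (hr : 0 < r) :
    tScale (k*p) (k*q) (k*r) = tScale p q r := by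
  unfold tScale
  rw [div_eq_div_iff (by positivity) (by positivity)]
  ring

lemma tScale_swap (p q r : ℝ) : tScale q p r = tScale p q r := by
  unfold tScale
  congr 1 <;> ring

lemma tScale_rot (p q r : ℝ) : tScale r p q = tScale p q r := by
  unfold tScale
  congr 1 <;> ring

/-- One-sided comparison of solutions. -/
lemma le_aux (z₁ z₂ z₃ u v w u' v' w' l : ℝ) (h₁ : 0 < z₁)
    (hu : 0 < u) (hv : 0 < v) (hw : 0 < w) (hu' : 0 < u') (hv' : 0 < v') (hw' : 0 < w')
    (e₁ : 1/u - 1/(v+w) = z₁) (e₁' : 1/u' - 1/(v'+w') = z₁)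
    (hl : 1 < l) (hlu : u' = l * u) (hlv : v' ≤ l * v) (hlw : w' ≤ l * w) : False := by
  have h1 : 1/(l*(v+w)) ≤ 1/(v'+w') := by
    apply one_div_le_one_div_of_le (by positivity); linarith
  have h2 : 1/u' = 1/l * (1/u) := by rw [hlu]; field_simp
  have h3 : 1/(l*(v+w)) = 1/l*(1/(v+w)) := by field_simp
  have h4 : 1/l < 1 := by rw [div_lt_one (by linarith)]; exact hl
  have h5 : z₁ ≤ 1/l * z₁ := by
    calc z₁ = 1/u' - 1/(v'+w') := e₁'.symm
      _ ≤ 1/l*(1/u) - 1/l*(1/(v+w)) := by linarith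
      _ = 1/l * z₁ := by rw [← e₁]; ring
  nlinarith

lemma le_sol (z₁ z₂ z₃ u v w u' v' w' : ℝ) (h₁ : 0 < z₁) (h₂ : 0 < z₂) (h₃ : 0 < z₃)
    (hu : 0 < u) (hv : 0 < v) (hw : 0 < w) (hu' : 0 < u') (hv' : 0 < v') (hw' : 0 < w')
    (e₁ : 1/u - 1/(v+w) = z₁) (e₂ : 1/v - 1/(u+w) = z₂) (e₃ : 1/w - 1/(u+v) = z₃)
    (e₁' : 1/u' - 1/(v'+w') = z₁) (e₂' : 1/v' - 1/(u'+w') = z₂)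
    (e₃' : 1/w' - 1/(u'+v') = z₃) : u' ≤ u ∧ v' ≤ v ∧ w' ≤ w := by
  obtain ⟨l, hl, m1, m2, m3⟩ : ∃ l : ℝ, (u' = l*u ∨ v' = l*v ∨ w' = l*w) ∧
      u' ≤ l*u ∧ v' ≤ l*v ∧ w' ≤ l*w := by
    refine ⟨max (u'/u) (max (v'/v) (w'/w)), ?_, ?_, ?_, ?_⟩
    · rcases max_choice (u'/u) (max (v'/v) (w'/w)) with h | h
      · left; rw [h]; field_simp
      · rw [h]
        rcases max_choice (v'/v) (w'/w) with h | h
        · right; left; rw [h]; field_simp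
        · right; right; rw [h]; field_simp
    · rw [← div_le_iff₀ hu]; simp
    · rw [← div_le_iff₀ hv]; simp
    · rw [← div_le_iff₀ hw]; simp
  have hle : l ≤ 1 := by
    by_contra hlt
    push Not at hlt
    rcases hl with h | h | h
    · exact le_aux z₁ z₂ z₃ u v w u' v' w' l h₁ hu hv hw hu' hv' hw' e₁ e₁' hlt h m2 m3
    · exact le_aux z₂ z₂ z₃ v u w v' u' w' l h₂ hv hu hw hv' hu' hw' e₂ e₂' hlt h m1 m3
    · exact le_aux z₃ z₂ z₃ w u v w' u' v' l h₃ hw hu hv hw' hu' hv' e₃ e₃' hlt h m1 m2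
  refine ⟨?_, ?_, ?_⟩ <;> nlinarith

lemma G_facts (z e M x y : ℝ) (hz : 0 < z) (he : 0 < e) (h2 : 2*z*e ≤ 1) (hM : 1/z ≤ M)
    (hx : e ≤ x) (hy : e ≤ y) :
    e ≤ 1/(z+1/(x+y)) ∧ 1/(z+1/(x+y)) ≤ M := by
  have hxp : 0 < x := by linarith
  have hyp : 0 < y := by linarith
  constructor
  · rw [le_div_iff₀ (by positivity)]
    have : 1/(x+y) ≤ 1/(2*e) := one_div_le_one_div_of_le (by positivity) (by linarith)
    have h3 : e * (1/(2*e)) = 1/2 := by field_simp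
    nlinarith
  · refine le_trans ?_ hM
    apply one_div_le_one_div_of_le hz
    have : 0 < 1/(x+y) := by positivity
    linarith

lemma G_mono (z x y x' y' : ℝ) (hz : 0 < z) (hx : 0 < x) (hy : 0 < y)
    (hx' : x ≤ x') (hy' : y ≤ y') :
    1/(z+1/(x+y)) ≤ 1/(z+1/(x'+y')) := by
  have : 0 < x' := by linarith
  have : 0 < y' := by linarith
  apply one_div_le_one_div_of_le (by positivity)
  have : 1/(x'+y') ≤ 1/(x+y) := one_div_le_one_div_of_le (by positivity) (by linarith)
  linarith

lemma exists_sol (z₁ z₂ z₃ : ℝ) (h₁ : 0 < z₁) (h₂ : 0 < z₂) (h₃ : 0 < z₃) :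
    ∃ u v w : ℝ, 0 < u ∧ 0 < v ∧ 0 < w ∧
      1/u - 1/(v+w) = z₁ ∧ 1/v - 1/(u+w) = z₂ ∧ 1/w - 1/(u+v) = z₃ := by
  obtain ⟨e, he, k1, k2, k3⟩ : ∃ e : ℝ, 0 < e ∧ 2*z₁*e ≤ 1 ∧ 2*z₂*e ≤ 1 ∧ 2*z₃*e ≤ 1 := by
    refine ⟨1/(2*(z₁+z₂+z₃)), by positivity, ?_, ?_, ?_⟩ <;>
    · rw [mul_one_div, div_le_one (by positivity)]; linarith
  obtain ⟨M, m1, m2, m3⟩ : ∃ M : ℝ, 1/z₁ ≤ M ∧ 1/z₂ ≤ M ∧ 1/z₃ ≤ M := by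
    have : 0 < 1/z₁ := by positivity
    have : 0 < 1/z₂ := by positivity
    have : 0 < 1/z₃ := by positivity
    exact ⟨1/z₁+1/z₂+1/z₃, by linarith, by linarith, by linarith⟩
  have heM : e ≤ M := by
    have := G_facts z₁ e M e e h₁ he k1 m1 le_rfl le_rfl
    linarith [this.1, this.2]
  have : Fact (e ≤ M) := ⟨heM⟩
  let I := Set.Icc e M
  let f : (I × I × I) →o (I × I × I) :=
    { toFun := fun x =>
        (⟨1/(z₁+1/((x.2.1:ℝ)+x.2.2)), G_facts z₁ e M _ _ h₁ he k1 m1 x.2.1.2.1 x.2.2.2.1⟩,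
         ⟨1/(z₂+1/((x.1:ℝ)+x.2.2)), G_facts z₂ e M _ _ h₂ he k2 m2 x.1.2.1 x.2.2.2.1⟩,
         ⟨1/(z₃+1/((x.1:ℝ)+x.2.1)), G_facts z₃ e M _ _ h₃ he k3 m3 x.1.2.1 x.2.1.2.1⟩)
      monotone' := by
        intro x y hxy
        have a1 : (x.1:ℝ) ≤ y.1 := hxy.1
        have a2 : (x.2.1:ℝ) ≤ y.2.1 := hxy.2.1
        have a3 : (x.2.2:ℝ) ≤ y.2.2 := hxy.2.2
        have b1 : 0 < (x.1:ℝ) := lt_of_lt_of_le he x.1.2.1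
        have b2 : 0 < (x.2.1:ℝ) := lt_of_lt_of_le he x.2.1.2.1
        have b3 : 0 < (x.2.2:ℝ) := lt_of_lt_of_le he x.2.2.2.1
        exact ⟨G_mono _ _ _ _ _ h₁ b2 b3 a2 a3, G_mono _ _ _ _ _ h₂ b1 b3 a1 a3,
          G_mono _ _ _ _ _ h₃ b1 b2 a1 a2⟩ }
  have hf : f f.lfp = f.lfp := f.map_lfp
  generalize f.lfp = x at hf
  have b1 : 0 < (x.1:ℝ) := lt_of_lt_of_le he x.1.2.1
  have b2 : 0 < (x.2.1:ℝ) := lt_of_lt_of_le he x.2.1.2.1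
  have b3 : 0 < (x.2.2:ℝ) := lt_of_lt_of_le he x.2.2.2.1
  have c1 : 1/(z₁+1/((x.2.1:ℝ)+x.2.2)) = x.1 := congrArg (fun t => (t.1 : ℝ)) hf
  have c2 : 1/(z₂+1/((x.1:ℝ)+x.2.2)) = x.2.1 := congrArg (fun t => (t.2.1 : ℝ)) hf
  have c3 : 1/(z₃+1/((x.1:ℝ)+x.2.1)) = x.2.2 := congrArg (fun t => (t.2.2 : ℝ)) hf
  refine ⟨x.1, x.2.1, x.2.2, b1, b2, b3, ?_, ?_, ?_⟩
  · have : 1/(x.1:ℝ) = z₁+1/((x.2.1:ℝ)+x.2.2) := by rw [← c1, one_div_one_div]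
    linarith
  · have : 1/(x.2.1:ℝ) = z₂+1/((x.1:ℝ)+x.2.2) := by rw [← c2, one_div_one_div]
    linarith
  · have : 1/(x.2.2:ℝ) = z₃+1/((x.1:ℝ)+x.2.1) := by rw [← c3, one_div_one_div]
    linarith

/-- All three key identities at once. -/
lemma key3 (p q r : ℝ) (hp : 0 < p) (hq : 0 < q) (hr : 0 < r)
    (hA : 0 < p*q+p*r-q*r) (hB : 0 < p*q+q*r-p*r) (hC : 0 < p*r+q*r-p*q)
    (t : ℝ) (ht : tScale p q r = t) :
    1/(t/p) - 1/(t/q + t/r) = 1/crossX ((q+r)/2) ((p+r)/2) ((p+q)/2) ∧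
    1/(t/q) - 1/(t/p + t/r) = 1/crossX ((p+r)/2) ((q+r)/2) ((p+q)/2) ∧
    1/(t/r) - 1/(t/p + t/q) = 1/crossX ((p+q)/2) ((q+r)/2) ((p+r)/2) := by
  refine ⟨?_, ?_, ?_⟩
  · rw [← ht]; exact key p q r hp hq hr hA hB hC
  · have := key q p r hq hp hr (by linarith) (by linarith) (by linarith)
    rw [tScale_swap, ht, add_comm q p] at this
    exact this
  · have := key r p q hr hp hq (by linarith) (by linarith) (by linarith)
    rw [tScale_rot, ht, add_comm r q, add_comm r p] at this
    have e : crossX ((p+q)/2) ((q+r)/2) ((p+r)/2) = crossX ((p+q)/2) ((q+r)/2) ((p+r)/2) := rfl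
    exact this

/-- Positivity of the Ravi variables. -/
lemma ravi_pos (a b c y₁ y₂ y₃ : ℝ) (ha : 0 < a) (hb : 0 < b) (hc : 0 < c)
    (h₁ : 0 < y₁) (h₂ : 0 < y₂) (h₃ : 0 < y₃)
    (e₁ : crossX a b c = y₁) (e₂ : crossX b a c = y₂) (e₃ : crossX c a b = y₃) :
    ∃ p q r : ℝ, 0 < p ∧ 0 < q ∧ 0 < r ∧ 0 < p*q+p*r-q*r ∧ 0 < p*q+q*r-p*r ∧
      0 < p*r+q*r-p*q ∧ a = (q+r)/2 ∧ b = (p+r)/2 ∧ c = (p+q)/2 := by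
  obtain ⟨p, hp⟩ : ∃ p, p = b+c-a := ⟨_, rfl⟩
  obtain ⟨q, hq⟩ : ∃ q, q = a+c-b := ⟨_, rfl⟩
  obtain ⟨r, hr⟩ : ∃ r, r = a+b-c := ⟨_, rfl⟩
  obtain ⟨A, hA⟩ : ∃ A, A = p*q+p*r-q*r := ⟨_, rfl⟩
  obtain ⟨B, hB⟩ : ∃ B, B = p*q+q*r-p*r := ⟨_, rfl⟩
  obtain ⟨C, hC⟩ : ∃ C, C = p*r+q*r-p*q := ⟨_, rfl⟩
  have hBC : 0 < C * B := by
    have h : 0 < crossX a b c := by rw [e₁]; exact h₁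
    unfold crossX at h
    have h' := (div_pos_iff_of_pos_right (by positivity)).1 h
    refine lt_of_lt_of_eq h' ?_
    rw [hB, hC, hp, hq, hr]; ring
  have hAC : 0 < C * A := by
    have h : 0 < crossX b a c := by rw [e₂]; exact h₂
    unfold crossX at h
    have h' := (div_pos_iff_of_pos_right (by positivity)).1 h
    refine lt_of_lt_of_eq h' ?_
    rw [hA, hC, hp, hq, hr]; ring
  have hAB : 0 < B * A := by
    have h : 0 < crossX c a b := by rw [e₃]; exact h₃
    unfold crossX at h
    have h' := (div_pos_iff_of_pos_right (by positivity)).1 h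
    refine lt_of_lt_of_eq h' ?_
    rw [hA, hB, hp, hq, hr]; ring
  have hABC : 0 < A ∧ 0 < B ∧ 0 < C := by
    rcases pos_and_pos_or_neg_and_neg_of_mul_pos hBC with ⟨c1, c2⟩ | ⟨c1, c2⟩
    · exact ⟨pos_of_mul_pos_right hAC c1.le |> fun h => by nlinarith, c2, c1⟩
    · exfalso
      have a1 : A < 0 := by nlinarith
      have n1 : p*q < 0 := by nlinarith
      have n2 : p*r < 0 := by nlinarith
      have n3 : q*r < 0 := by nlinarith
      nlinarith [mul_pos_of_neg_of_neg n1 n2, sq_nonneg p]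
  obtain ⟨pA, pB, pC⟩ := hABC
  have n1 : 0 < p*q := by linarith
  have n2 : 0 < p*r := by linarith
  have n3 : 0 < q*r := by linarith
  have hq0 : 0 < q := by
    rcases pos_and_pos_or_neg_and_neg_of_mul_pos n3 with ⟨c1, c2⟩ | ⟨c1, c2⟩ <;> linarith
  have hr0 : 0 < r := (pos_iff_pos_of_mul_pos n3).1 hq0
  have hp0 : 0 < p := (pos_iff_pos_of_mul_pos n1).2 hq0
  exact ⟨p, q, r, hp0, hq0, hr0, hA ▸ pA, hB ▸ pB, hC ▸ pC, by linarith, by linarith, by linarith⟩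

theorem stmt_17 (y₁ y₂ y₃ : ℝ) (h₁ : 0 < y₁) (h₂ : 0 < y₂) (h₃ : 0 < y₃) :
    ∃! ρ : ℝ × ℝ × ℝ,
      (0 < ρ.1 ∧ 0 < ρ.2.1 ∧ 0 < ρ.2.2) ∧
      crossX ρ.1 ρ.2.1 ρ.2.2 = y₁ ∧
      crossX ρ.2.1 ρ.1 ρ.2.2 = y₂ ∧
      crossX ρ.2.2 ρ.1 ρ.2.1 = y₃ := by
  have i₁ : 0 < 1/y₁ := by positivity
  have i₂ : 0 < 1/y₂ := by positivity
  have i₃ : 0 < 1/y₃ := by positivity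
  apply existsUnique_of_exists_of_unique
  · obtain ⟨u, v, w, hu, hv, hw, e₁, e₂, e₃⟩ := exists_sol _ _ _ i₁ i₂ i₃
    have hpos : ∀ x s z : ℝ, 0 < x → 0 < s → 0 < z → 1/x - 1/s = z → x < s := by
      intro x s z hx hs hz h
      exact (one_div_lt_one_div hs hx).1 (by linarith)
    have t1 := hpos u (v+w) _ hu (by positivity) i₁ e₁
    have t2 := hpos v (u+w) _ hv (by positivity) i₂ e₂
    have t3 := hpos w (u+v) _ hw (by positivity) i₃ e₃
    have hA : ∀ k : ℝ, 0 < k → 0 < (k*(1/u))*(k*(1/v))+(k*(1/u))*(k*(1/w))-(k*(1/v))*(k*(1/w)) := by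
      intro k hk
      have : (k*(1/u))*(k*(1/v))+(k*(1/u))*(k*(1/w))-(k*(1/v))*(k*(1/w))
        = k^2*(v+w-u)/(u*v*w) := by field_simp; ring
      rw [this]; exact div_pos (mul_pos (by positivity) (by linarith)) (by positivity)
    have hB : ∀ k : ℝ, 0 < k → 0 < (k*(1/u))*(k*(1/v))+(k*(1/v))*(k*(1/w))-(k*(1/u))*(k*(1/w)) := by
      intro k hk
      have : (k*(1/u))*(k*(1/v))+(k*(1/v))*(k*(1/w))-(k*(1/u))*(k*(1/w))
        = k^2*(u+w-v)/(u*v*w) := by field_simp; ring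
      rw [this]; exact div_pos (mul_pos (by positivity) (by linarith)) (by positivity)
    have hC : ∀ k : ℝ, 0 < k → 0 < (k*(1/u))*(k*(1/w))+(k*(1/v))*(k*(1/w))-(k*(1/u))*(k*(1/v)) := by
      intro k hk
      have : (k*(1/u))*(k*(1/w))+(k*(1/v))*(k*(1/w))-(k*(1/u))*(k*(1/v))
        = k^2*(u+v-w)/(u*v*w) := by field_simp; ring
      rw [this]; exact div_pos (mul_pos (by positivity) (by linarith)) (by positivity)
    obtain ⟨k, hk⟩ : ∃ k, tScale (1/u) (1/v) (1/w) = k := ⟨_, rfl⟩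
    have hk0 : 0 < k := by
      rw [← hk]
      have a1 := hA 1 one_pos
      have a2 := hB 1 one_pos
      have a3 := hC 1 one_pos
      simp only [one_mul] at a1 a2 a3
      unfold tScale
      positivity
    have hs := tScale_smul k (1/u) (1/v) (1/w) hk0 (by positivity) (by positivity) (by positivity)
    obtain ⟨f1, f2, f3⟩ := key3 (k*(1/u)) (k*(1/v)) (k*(1/w)) (by positivity) (by positivity)
      (by positivity) (hA k hk0) (hB k hk0) (hC k hk0) k (hs.trans hk)
    have g : ∀ x : ℝ, 0 < x → k/(k*(1/x)) = x := by
      intro x hx; field_simp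
    rw [g u hu, g v hv, g w hw] at f1 f2 f3
    rw [e₁] at f1
    rw [e₂] at f2
    rw [e₃] at f3
    refine ⟨((k*(1/v)+k*(1/w))/2, (k*(1/u)+k*(1/w))/2, (k*(1/u)+k*(1/v))/2),
      ⟨by positivity, by positivity, by positivity⟩, ?_, ?_, ?_⟩
    · simpa using f1.symm
    · simpa using f2.symm
    · simpa using f3.symm
  · rintro ⟨a, b, c⟩ ⟨a', b', c'⟩ ⟨⟨ha, hb, hc⟩, e₁, e₂, e₃⟩ ⟨⟨ha', hb', hc'⟩, e₁', e₂', e₃'⟩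
    simp only at *
    obtain ⟨p, q, r, hp, hq, hr, hA, hB, hC, rfl, rfl, rfl⟩ :=
      ravi_pos a b c y₁ y₂ y₃ ha hb hc h₁ h₂ h₃ e₁ e₂ e₃
    obtain ⟨p', q', r', hp', hq', hr', hA', hB', hC', rfl, rfl, rfl⟩ :=
      ravi_pos a' b' c' y₁ y₂ y₃ ha' hb' hc' h₁ h₂ h₃ e₁' e₂' e₃'
    obtain ⟨t, ht⟩ : ∃ t, tScale p q r = t := ⟨_, rfl⟩
    obtain ⟨t', ht'⟩ : ∃ t, tScale p' q' r' = t := ⟨_, rfl⟩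
    have t0 : 0 < t := by rw [← ht]; unfold tScale; positivity
    have t0' : 0 < t' := by rw [← ht']; unfold tScale; positivity
    obtain ⟨f1, f2, f3⟩ := key3 p q r hp hq hr hA hB hC t ht
    obtain ⟨f1', f2', f3'⟩ := key3 p' q' r' hp' hq' hr' hA' hB' hC' t' ht'
    rw [e₁] at f1
    rw [e₂] at f2
    rw [e₃] at f3
    rw [e₁'] at f1'
    rw [e₂'] at f2'
    rw [e₃'] at f3'
    have l1 := le_sol _ _ _ (t/p) (t/q) (t/r) (t'/p') (t'/q') (t'/r') i₁ i₂ i₃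
      (by positivity) (by positivity) (by positivity) (by positivity) (by positivity)
      (by positivity) f1 f2 f3 f1' f2' f3'
    have l2 := le_sol _ _ _ (t'/p') (t'/q') (t'/r') (t/p) (t/q) (t/r) i₁ i₂ i₃
      (by positivity) (by positivity) (by positivity) (by positivity) (by positivity)
      (by positivity) f1' f2' f3' f1 f2 f3
    have gg : ∀ x x' : ℝ, 0 < x → 0 < x' → t'/x' ≤ t/x → t/x ≤ t'/x' → x' = t'/t*x := by
      intro x x' hx hx' k1 k2
      have := le_antisymm k1 k2
      field_simp at this ⊢
      linarith
    have q1 := gg p p' hp hp' l1.1 l2.1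
    have q2 := gg q q' hq hq' l1.2.1 l2.2.1
    have q3 := gg r r' hr hr' l1.2.2 l2.2.2
    have hs := tScale_smul (t'/t) p q r (by positivity) hp hq hr
    rw [← q1, ← q2, ← q3, ht, ht'] at hs
    rw [hs, div_self t0.ne', one_mul] at q1 q2 q3
    rw [q1, q2, q3]
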